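/- There is a universal constant c > 0 such that the following holds. Let P ⊆ ℝ² be a finite set of n points whose weighted unit-distance graph G is connected, let ε ∈ (0,1), let r > 16, and let Q be an (r/2)-packing of P with respect to d_G. Then the number of unordered pairs {x, y} of distinct points of Q with 2r/ε ≤ d_G(x, y) ≤ 16r/ε is at most c·n/ε². -/

import Mathlib

open Metric Set

/-- A path in the weighted unit-distance graph of `P`: a finite sequence of points
of `P` in which consecutive points are at distance at most `1`. -/
def IsUDPath {α : Type*} [MetricSpace α] (P : Set α) (m : ℕ) (f : Fin (m + 1) → α) : Prop :=
  (∀ i, f i ∈ P) ∧ ∀ i : Fin m, dist (f i.castSucc) (f i.succ) ≤ 1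

/-- The length of a path: the sum of the lengths of its edges. -/
noncomputable def udLen {α : Type*} [MetricSpace α] (m : ℕ) (f : Fin (m + 1) → α) : ℝ :=
  ∑ i : Fin m, dist (f i.castSucc) (f i.succ)

/-- The weighted unit-distance graph of `P` is connected. -/
def UDConnected {α : Type*} [MetricSpace α] (P : Set α) : Prop :=
  ∀ x ∈ P, ∀ y ∈ P, ∃ m, ∃ f : Fin (m + 1) → α,
    IsUDPath P m f ∧ f 0 = x ∧ f (Fin.last m) = y

/-- The shortest-path metric of the weighted unit-distance graph of `P`. -/
noncomputable def dG {α : Type*} [MetricSpace α] (P : Set α) (x y : α) : ℝ :=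
  sInf {t | ∃ m, ∃ f : Fin (m + 1) → α,
    IsUDPath P m f ∧ f 0 = x ∧ f (Fin.last m) = y ∧ udLen m f = t}

/-- `Q` is an `r`-packing of `P` with respect to the shortest-path metric `d_G`. -/
def IsPackingG {α : Type*} [MetricSpace α] (P Q : Set α) (r : ℝ) : Prop :=
  Q ⊆ P ∧ (∀ p ∈ P, ∃ q ∈ Q, dG P p q < r) ∧
    ∀ q ∈ Q, ∀ q' ∈ Q, q ≠ q' → r ≤ dG P q q'

/-- Inductive reformulation of "there is a path from `x` to `y` of length `t`". -/
inductive UDReach {α : Type*} [MetricSpace α] (P : Set α) (x : α) : α → ℝ → Prop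
  | refl : x ∈ P → UDReach P x x 0
  | snoc {y z : α} {t : ℝ} : UDReach P x y t → z ∈ P → dist y z ≤ 1 →
      UDReach P x z (t + dist y z)

section Helpers
variable {α : Type*} [MetricSpace α] {P : Set α}

theorem UDReach.of_path (m : ℕ) : ∀ (f : Fin (m + 1) → α), IsUDPath P m f →
    UDReach P (f 0) (f (Fin.last m)) (udLen m f) := by
  induction m with
  | zero =>
    intro f hf
    simpa [udLen] using UDReach.refl (hf.1 0)
  | succ m ih =>
    intro f hf
    have h := ih (fun i => f i.castSucc) ⟨fun i => hf.1 _, fun i => hf.2 i.castSucc⟩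
    have h2 := UDReach.snoc h (hf.1 (Fin.last (m + 1))) (hf.2 (Fin.last m))
    have e : udLen (m + 1) f = udLen m (fun i => f i.castSucc) +
        dist (f (Fin.last m).castSucc) (f (Fin.last (m + 1))) := by
      unfold udLen
      rw [Fin.sum_univ_castSucc]
      rfl
    rw [e]
    exact h2

theorem UDReach.to_path {x y : α} {t : ℝ} (h : UDReach P x y t) :
    ∃ m, ∃ f : Fin (m + 1) → α, IsUDPath P m f ∧ f 0 = x ∧ f (Fin.last m) = y ∧
      udLen m f = t := by
  induction h with
  | refl hx =>
    exact ⟨0, fun _ => x, ⟨fun _ => hx, fun i => i.elim0⟩, rfl, rfl, by simp [udLen]⟩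
  | @snoc y z t h hz hd ih =>
    obtain ⟨m, f, hf, h0, hl, ht⟩ := ih
    have h1 : ∀ i : Fin (m + 1), (Fin.snoc f z : Fin (m + 2) → α) i.castSucc = f i :=
      fun i => Fin.snoc_castSucc (α := fun _ => α) z f i
    have h2 : (Fin.snoc f z : Fin (m + 2) → α) (Fin.last (m + 1)) = z :=
      Fin.snoc_last (α := fun _ => α) z f
    refine ⟨m + 1, (Fin.snoc f z : Fin (m + 2) → α), ⟨?_, ?_⟩, ?_, h2, ?_⟩
    · intro i
      refine Fin.lastCases ?_ (fun j => ?_) i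
      · rw [h2]; exact hz
      · rw [h1]; exact hf.1 j
    · intro i
      refine Fin.lastCases ?_ (fun j => ?_) i
      · rw [h1, Fin.succ_last, h2, hl]; exact hd
      · rw [h1, Fin.succ_castSucc, h1]; exact hf.2 j
    · rw [← Fin.castSucc_zero, h1, h0]
    · unfold udLen
      rw [Fin.sum_univ_castSucc, h1, Fin.succ_last, h2, hl, ← ht]
      unfold udLen
      congr 1
      refine Finset.sum_congr rfl fun j _ => ?_
      rw [h1, Fin.succ_castSucc, h1]

theorem dG_eq (x y : α) : dG P x y = sInf {t | UDReach P x y t} := by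
  unfold dG
  congr 1
  ext t
  constructor
  · rintro ⟨m, f, hf, rfl, rfl, rfl⟩
    exact UDReach.of_path m f hf
  · exact fun h => h.to_path

theorem UDReach.mem_left {x y : α} {t : ℝ} (h : UDReach P x y t) : x ∈ P := by
  induction h with
  | refl hx => exact hx
  | snoc _ _ _ ih => exact ih

theorem UDReach.mem_right {x y : α} {t : ℝ} (h : UDReach P x y t) : y ∈ P := by
  cases h <;> assumption

theorem UDReach.trans {x y z : α} {s t : ℝ} (h : UDReach P x y s) (h' : UDReach P y z t) :
    UDReach P x z (s + t) := by
  induction h' with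
  | refl _ => simpa using h
  | snoc _ hz hd ih => rw [← add_assoc]; exact ih.snoc hz hd

theorem UDReach.single {x y : α} (hx : x ∈ P) (hy : y ∈ P) (h : dist x y ≤ 1) :
    UDReach P x y (dist x y) := by
  simpa using (UDReach.refl hx).snoc hy h

theorem UDReach.symm {x y : α} {t : ℝ} (h : UDReach P x y t) : UDReach P y x t := by
  induction h with
  | refl hx => exact UDReach.refl hx
  | @snoc y z t h hz hd ih =>
    rw [add_comm, dist_comm]
    exact (UDReach.single hz h.mem_right (by rwa [dist_comm])).trans ih

theorem UDReach.dist_le {x y : α} {t : ℝ} (h : UDReach P x y t) : dist x y ≤ t := by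
  induction h with
  | refl hx => simp
  | @snoc y z t h hz hd ih => linarith [dist_triangle x y z]

theorem dG_le {x y : α} {t : ℝ} (h : UDReach P x y t) : dG P x y ≤ t := by
  rw [dG_eq]
  exact csInf_le ⟨dist x y, fun s hs => UDReach.dist_le hs⟩ h

theorem UDConnected.nonempty (hc : UDConnected P) {x y : α} (hx : x ∈ P) (hy : y ∈ P) :
    {t | UDReach P x y t}.Nonempty := by
  obtain ⟨m, f, hf, rfl, rfl⟩ := hc x hx y hy
  exact ⟨_, UDReach.of_path m f hf⟩

theorem le_dG (hc : UDConnected P) {x y : α} (hx : x ∈ P) (hy : y ∈ P) {b : ℝ}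
    (h : ∀ t, UDReach P x y t → b ≤ t) : b ≤ dG P x y := by
  rw [dG_eq]
  exact le_csInf (hc.nonempty hx hy) h

theorem dist_le_dG (hc : UDConnected P) {x y : α} (hx : x ∈ P) (hy : y ∈ P) :
    dist x y ≤ dG P x y := le_dG hc hx hy fun _ h => h.dist_le

theorem dG_comm (x y : α) : dG P x y = dG P y x := by
  rw [dG_eq, dG_eq]
  congr 1
  ext t
  exact ⟨UDReach.symm, UDReach.symm⟩

theorem dG_triangle (hc : UDConnected P) {x y z : α} (hx : x ∈ P) (hy : y ∈ P) (hz : z ∈ P) :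
    dG P x z ≤ dG P x y + dG P y z := by
  have : dG P x z - dG P y z ≤ dG P x y := by
    refine le_dG hc hx hy fun s hs => ?_
    have : dG P x z - s ≤ dG P y z := by
      refine le_dG hc hy hz fun t ht => ?_
      linarith [dG_le (hs.trans ht)]
    linarith
  linarith

theorem dG_le_one {x y : α} (hx : x ∈ P) (hy : y ∈ P) (h : dist x y ≤ 1) : dG P x y ≤ 1 :=
  (dG_le (UDReach.single hx hy h)).trans h

theorem exists_level (hc : UDConnected P) {x y : α} {s : ℝ} (h : UDReach P x y s) {t : ℝ}
    (ht0 : 0 ≤ t) (ht : t ≤ dG P x y) : ∃ p ∈ P, t ≤ dG P x p ∧ dG P x p < t + 1 := by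
  induction h with
  | refl hx =>
    have := dG_le (UDReach.refl hx)
    exact ⟨x, hx, ht, by linarith⟩
  | @snoc y z u h hz hd ih =>
    by_cases hty : t ≤ dG P x y
    · exact ih hty
    · refine ⟨z, hz, ht, ?_⟩
      have h1 := dG_triangle hc h.mem_left h.mem_right hz
      have h2 := dG_le_one h.mem_right hz hd
      linarith

end Helpers

/-- Grid cell (side `1/2`) of a point of the plane. -/
noncomputable def udCell (p : EuclideanSpace ℝ (Fin 2)) : ℤ × ℤ := (⌊2 * p 0⌋, ⌊2 * p 1⌋)

theorem dist_le_one_of_udCell {p q : EuclideanSpace ℝ (Fin 2)} (h : udCell p = udCell q) :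
    dist p q ≤ 1 := by
  simp only [udCell, Prod.mk.injEq] at h
  have h0 := abs_lt.1 (Int.abs_sub_lt_one_of_floor_eq_floor h.1)
  have h1 := abs_lt.1 (Int.abs_sub_lt_one_of_floor_eq_floor h.2)
  rw [EuclideanSpace.dist_eq, Real.sqrt_le_iff, Fin.sum_univ_two, Real.dist_eq, Real.dist_eq,
    sq_abs, sq_abs]
  exact ⟨zero_le_one, by nlinarith⟩

theorem abs_coord_le (p q : EuclideanSpace ℝ (Fin 2)) (i : Fin 2) : |q i - p i| ≤ dist p q := by
  have := PiLp.norm_apply_le (q - p) i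
  rw [dist_comm, dist_eq_norm]
  simpa using this

theorem card_Icc_floor (a R : ℝ) (hR : 2 ≤ R) :
    ((Finset.Icc ⌊2 * (a - R)⌋ ⌊2 * (a + R)⌋).card : ℝ) ≤ 5 * R := by
  rw [Int.card_Icc]
  have h1 := Int.floor_le (2 * (a + R))
  have h2 := Int.lt_floor_add_one (2 * (a - R))
  have h3 : ⌊2 * (a - R)⌋ ≤ ⌊2 * (a + R)⌋ := Int.floor_le_floor (by linarith)
  have h4 : (((⌊2 * (a + R)⌋ + 1 - ⌊2 * (a - R)⌋).toNat : ℤ) : ℝ) =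
      ((⌊2 * (a + R)⌋ + 1 - ⌊2 * (a - R)⌋ : ℤ) : ℝ) := by
    rw [Int.toNat_of_nonneg (by omega)]
  rw [Int.cast_natCast] at h4
  rw [h4]
  push_cast
  linarith

/-- **Few pairs per resolution.** There is a universal constant `c > 0` such that for
any `(r/2)`-packing `Q` (with `r > 16`) of a connected unit-distance graph on `n` points
in the plane, the number of unordered pairs `{x, y}` of distinct points of `Q` with
`2r/ε ≤ d_G(x,y) ≤ 16r/ε` is at most `c·n/ε²`. -/
theorem pairs_per_resolution_bound :
    ∃ c : ℝ, 0 < c ∧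
      ∀ (P : Set (EuclideanSpace ℝ (Fin 2))), P.Finite → UDConnected P →
      ∀ ε : ℝ, 0 < ε → ε < 1 →
      ∀ r : ℝ, 16 < r →
      ∀ Q : Set (EuclideanSpace ℝ (Fin 2)), IsPackingG P Q (r / 2) →
        (({z : Sym2 (EuclideanSpace ℝ (Fin 2)) |
            ∃ x ∈ Q, ∃ y ∈ Q, x ≠ y ∧ z = s(x, y) ∧
              2 * r / ε ≤ dG P x y ∧ dG P x y ≤ 16 * r / ε}).ncard : ℝ) ≤
          c * (P.ncard : ℝ) / ε ^ 2 := by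
  classical
  refine ⟨48 * 48 * 7225, by norm_num, ?_⟩
  intro P hP hc ε hε0 hε1 r hr Q hQ
  obtain ⟨hQP, -, hsep⟩ := hQ
  set S := {z : Sym2 (EuclideanSpace ℝ (Fin 2)) |
            ∃ x ∈ Q, ∃ y ∈ Q, x ≠ y ∧ z = s(x, y) ∧
              2 * r / ε ≤ dG P x y ∧ dG P x y ≤ 16 * r / ε} with hS
  rcases S.eq_empty_or_nonempty with hE | ⟨_, a, ha, b, hb, hab, -⟩
  · rw [hE]
    simp only [Set.ncard_empty, Nat.cast_zero]
    positivity
  -- levels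
  set k : ℕ := ⌊(r / 8 - 1) / 3⌋₊ + 1 with hk
  have hkr : r / 48 ≤ (k : ℝ) := by
    have := Nat.lt_floor_add_one ((r / 8 - 1) / 3)
    rw [hk]; push_cast
    linarith
  have hjk : ∀ j : Fin k, 3 * ((j : ℕ) : ℝ) + 1 ≤ r / 8 := by
    intro j
    have h1 : (j : ℕ) ≤ ⌊(r / 8 - 1) / 3⌋₊ := by have := j.2; omega
    have h2 := Nat.floor_le (show 0 ≤ (r / 8 - 1) / 3 by linarith)
    have h3 : ((j : ℕ) : ℝ) ≤ (⌊(r / 8 - 1) / 3⌋₊ : ℝ) := by exact_mod_cast h1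
    linarith
  have hlev : ∀ x : EuclideanSpace ℝ (Fin 2), ∀ j : Fin k, ∃ p, x ∈ Q →
      p ∈ P ∧ 3 * ((j : ℕ) : ℝ) ≤ dG P x p ∧ dG P x p < 3 * ((j : ℕ) : ℝ) + 1 := by
    intro x j
    by_cases hx : x ∈ Q
    · obtain ⟨y, hy, hxy⟩ : ∃ y ∈ Q, x ≠ y := by
        by_cases h : x = a
        · exact ⟨b, hb, h ▸ hab⟩
        · exact ⟨a, ha, h⟩
      obtain ⟨s, hs⟩ := hc.nonempty (hQP hx) (hQP hy)
      have h1 := hsep x hx y hy hxy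
      obtain ⟨p, hp, h2, h3⟩ := exists_level hc hs (t := 3 * ((j : ℕ) : ℝ)) (by positivity)
        (by linarith [hjk j])
      exact ⟨p, fun _ => ⟨hp, h2, h3⟩⟩
    · exact ⟨x, fun h => absurd h hx⟩
  choose p hp using hlev
  have hinj : ∀ x ∈ Q, ∀ x' ∈ Q, ∀ j j' : Fin k, udCell (p x j) = udCell (p x' j') →
      x = x' ∧ j = j' := by
    intro x hx x' hx' j j' h
    obtain ⟨hpP, hp1, hp2⟩ := hp x j hx
    obtain ⟨hpP', hp1', hp2'⟩ := hp x' j' hx'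
    have hd := dG_le_one hpP hpP' (dist_le_one_of_udCell h)
    have hxx : x = x' := by
      by_contra hne
      have h1 := hsep x hx x' hx' hne
      have h2 := dG_triangle hc (hQP hx) hpP (hQP hx')
      have h3 := dG_triangle hc hpP hpP' (hQP hx')
      have h4 : dG P (p x' j') x' = dG P x' (p x' j') := dG_comm _ _
      linarith [hjk j, hjk j']
    subst hxx
    refine ⟨rfl, ?_⟩
    have h2 := dG_triangle hc (hQP hx) hpP hpP'
    have h3 := dG_triangle hc (hQP hx) hpP' hpP
    rw [dG_comm (p x j') (p x j)] at h3
    have h4 : ((j : ℕ) : ℝ) < (j' : ℕ) + 1 := by linarith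
    have h5 : ((j' : ℕ) : ℝ) < (j : ℕ) + 1 := by linarith
    have h4' : (j : ℕ) < (j' : ℕ) + 1 := by exact_mod_cast h4
    have h5' : (j' : ℕ) < (j : ℕ) + 1 := by exact_mod_cast h5
    exact Fin.ext (by omega)
  have hQfin : Q.Finite := hP.subset hQP
  set F := hQfin.toFinset with hF
  have hFQ : ∀ x, x ∈ F ↔ x ∈ Q := fun x => by simp [hF]
  -- global count
  have hQn : (F.card : ℝ) * k ≤ P.ncard := by
    rw [Set.ncard_eq_toFinset_card P hP]
    have : (F ×ˢ (Finset.univ : Finset (Fin k))).card ≤ hP.toFinset.card := by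
      refine Finset.card_le_card_of_injOn (fun z => p z.1 z.2) ?_ ?_
      · rintro ⟨x, j⟩ hz
        simp only [Finset.coe_product, Set.mem_prod, Finset.mem_coe, hFQ] at hz
        simpa using (hp x j hz.1).1
      · rintro ⟨x, j⟩ hz ⟨x', j'⟩ hz' h
        simp only [Finset.coe_product, Set.mem_prod, Finset.mem_coe, hFQ] at hz hz'
        obtain ⟨h1, h2⟩ := hinj x hz.1 x' hz'.1 j j' (congrArg udCell h)
        rw [h1, h2]
    rw [Finset.card_product, Finset.card_univ, Fintype.card_fin] at this
    exact_mod_cast this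
  -- local count
  set R := 17 * r / ε with hR
  have hrε : r ≤ r / ε := by
    rw [le_div_iff₀ hε0]; nlinarith
  have hR2 : 2 ≤ R := by
    have : R = 17 * (r / ε) := by rw [hR]; ring
    linarith
  have hloc : ∀ x ∈ F, ((F.filter fun y => dG P x y ≤ 16 * r / ε).card : ℝ) * k ≤
      (5 * R) * (5 * R) := by
    intro x hxF
    have hx := (hFQ x).1 hxF
    have : ((F.filter fun y => dG P x y ≤ 16 * r / ε) ×ˢ
        (Finset.univ : Finset (Fin k))).card ≤
        ((Finset.Icc ⌊2 * (x 0 - R)⌋ ⌊2 * (x 0 + R)⌋) ×ˢ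
         (Finset.Icc ⌊2 * (x 1 - R)⌋ ⌊2 * (x 1 + R)⌋)).card := by
      refine Finset.card_le_card_of_injOn (fun z => udCell (p z.1 z.2)) ?_ ?_
      · rintro ⟨y, j⟩ hz
        simp only [Finset.coe_product, Set.mem_prod, Finset.mem_coe, Finset.mem_filter, hFQ] at hz
        obtain ⟨⟨hy, hxy⟩, -⟩ := hz
        obtain ⟨hpP, hp1, hp2⟩ := hp y j hy
        have hd : dist x (p y j) ≤ R := by
          have h1 := dist_le_dG hc (hQP hx) hpP
          have h2 := dG_triangle hc (hQP hx) (hQP hy) hpP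
          have h3 : R = 16 * r / ε + r / ε := by rw [hR]; ring
          linarith [hjk j]
        have c0 := abs_le.1 ((abs_coord_le x (p y j) 0).trans hd)
        have c1 := abs_le.1 ((abs_coord_le x (p y j) 1).trans hd)
        simp only [Finset.coe_product, Set.mem_prod, Finset.mem_coe, Finset.mem_Icc, udCell]
        refine ⟨⟨?_, ?_⟩, ?_, ?_⟩ <;> apply Int.floor_le_floor <;> linarith [c0.1, c0.2, c1.1, c1.2]
      · rintro ⟨y, j⟩ hz ⟨y', j'⟩ hz' h
        simp only [Finset.coe_product, Set.mem_prod, Finset.mem_coe, Finset.mem_filter, hFQ]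
          at hz hz'
        obtain ⟨h1, h2⟩ := hinj y hz.1.1 y' hz'.1.1 j j' h
        rw [h1, h2]
    rw [Finset.card_product, Finset.card_product, Finset.card_univ, Fintype.card_fin] at this
    have this' : ((F.filter fun y => dG P x y ≤ 16 * r / ε).card : ℝ) * k ≤
        ((Finset.Icc ⌊2 * (x 0 - R)⌋ ⌊2 * (x 0 + R)⌋).card : ℝ) *
        ((Finset.Icc ⌊2 * (x 1 - R)⌋ ⌊2 * (x 1 + R)⌋).card : ℝ) := by exact_mod_cast this
    refine this'.trans ?_
    exact mul_le_mul (card_Icc_floor _ _ hR2) (card_Icc_floor _ _ hR2) (by positivity)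
      (by linarith)
  -- combine
  set T := F.sigma (fun x => F.filter fun y => dG P x y ≤ 16 * r / ε) with hT
  have hST : S ⊆ ((T.image fun z => s(z.1, z.2) : Finset (Sym2 (EuclideanSpace ℝ (Fin 2)))) :
      Set (Sym2 (EuclideanSpace ℝ (Fin 2)))) := by
    rintro _ ⟨x, hx, y, hy, -, rfl, -, hxy⟩
    rw [Finset.mem_coe, Finset.mem_image]
    refine ⟨⟨x, y⟩, ?_, rfl⟩
    rw [hT, Finset.mem_sigma, Finset.mem_filter, hFQ, hFQ]
    exact ⟨hx, hy, hxy⟩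
  have hcard : S.ncard ≤ T.card := by
    refine (Set.ncard_le_ncard hST (Finset.finite_toSet _)).trans ?_
    rw [Set.ncard_coe_finset]
    exact Finset.card_image_le
  have hTk : (T.card : ℝ) * k ≤ F.card * ((5 * R) * (5 * R)) := by
    rw [hT, Finset.card_sigma]
    push_cast
    rw [Finset.sum_mul, ← nsmul_eq_mul]
    exact Finset.sum_le_card_nsmul _ _ _ hloc
  have hkpos : (0 : ℝ) < k := by linarith
  have hfin : (T.card : ℝ) * (k * k) ≤ P.ncard * ((5 * R) * (5 * R)) := by
    calc (T.card : ℝ) * (k * k) = (T.card * k) * k := by ring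
      _ ≤ (F.card * ((5 * R) * (5 * R))) * k := by gcongr
      _ = (F.card * k) * ((5 * R) * (5 * R)) := by ring
      _ ≤ _ := by gcongr
  have hfin2 : (T.card : ℝ) * ((r / 48) * (r / 48)) ≤ P.ncard * ((5 * R) * (5 * R)) := by
    refine le_trans ?_ hfin
    gcongr
  have hS' : (S.ncard : ℝ) ≤ T.card := by exact_mod_cast hcard
  refine hS'.trans ?_
  have hr0 : 0 < (r / 48) * (r / 48) := by positivity
  refine le_of_mul_le_mul_right (hfin2.trans (le_of_eq ?_)) hr0
  rw [hR]
  field_simp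
  ring
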